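/- For every r > 0, the function G_r(s) = Σ_{k ∈ ℤ} exp(−r(s + 2πk)²) is strictly decreasing on (0, π). -/

import Mathlib

open Real

open Filter Topology

/-- The reciprocal `1 / (q²; q²)ₙ` of the `q`-Pochhammer symbol, extended by zero to negative `n`. -/
noncomputable def invQPochhammer (q : ℝ) (n : ℤ) : ℝ :=
  if n < 0 then 0 else ∏ j ∈ Finset.range n.toNat, (1 - q ^ (2 * (j + 1)))⁻¹

/-- The coefficients of the finite Jacobi triple product, up to normalisation. -/
noncomputable def tripleCoeff (q : ℝ) (N : ℕ) (k : ℤ) : ℝ :=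
  invQPochhammer q (N + k) * invQPochhammer q (N - k)

section

variable {q : ℝ}

lemma one_sub_pow_pos (h0 : 0 < q) (h1 : q < 1) {n : ℕ} (hn : n ≠ 0) : 0 < 1 - q ^ n :=
  sub_pos.2 (pow_lt_one₀ h0.le h1 hn)

lemma invQPochhammer_natCast (n : ℕ) :
    invQPochhammer q n = ∏ j ∈ Finset.range n, (1 - q ^ (2 * (j + 1)))⁻¹ := by
  simp [invQPochhammer]

lemma invQPochhammer_of_neg {n : ℤ} (hn : n < 0) : invQPochhammer q n = 0 := by
  simp [invQPochhammer, hn]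

lemma invQPochhammer_sub_one (h0 : 0 < q) (h1 : q < 1) (n : ℤ) :
    invQPochhammer q (n - 1) = (1 - q ^ (2 * n)) * invQPochhammer q n := by
  rcases lt_trichotomy n 0 with h | rfl | h
  · rw [invQPochhammer_of_neg h, invQPochhammer_of_neg (by omega), mul_zero]
  · rw [invQPochhammer_of_neg (by omega)]; simp
  · obtain ⟨m, rfl⟩ : ∃ m : ℕ, n = m + 1 := ⟨(n - 1).toNat, by omega⟩
    have h2 := (one_sub_pow_pos h0 h1 (n := 2 * (m + 1)) (by omega)).ne'
    have h3 : q ^ (2 * ((m : ℤ) + 1)) = q ^ (2 * (m + 1)) := by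
      rw [← zpow_natCast]; push_cast; rfl
    have h4 := invQPochhammer_natCast (q := q) (m + 1)
    push_cast at h4
    rw [add_sub_cancel_right, h3, h4, Finset.prod_range_succ, invQPochhammer_natCast]
    field_simp

lemma one_le_inv_one_sub_pow (h0 : 0 < q) (h1 : q < 1) (j : ℕ) :
    1 ≤ (1 - q ^ (2 * (j + 1)))⁻¹ :=
  (one_le_inv₀ (one_sub_pow_pos h0 h1 (by omega))).2 (by linarith [pow_pos h0 (2 * (j + 1))])

lemma invQPochhammer_nonneg (h0 : 0 < q) (h1 : q < 1) (n : ℤ) : 0 ≤ invQPochhammer q n := by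
  unfold invQPochhammer
  split_ifs
  · exact le_rfl
  · exact Finset.prod_nonneg fun j _ => zero_le_one.trans (one_le_inv_one_sub_pow h0 h1 j)

lemma exists_tendsto_invQPochhammer (h0 : 0 < q) (h1 : q < 1) :
    ∃ E : ℝ, 0 < E ∧ Tendsto (invQPochhammer q) atTop (𝓝 E) ∧ ∀ n, invQPochhammer q n ≤ E := by
  have hs : Summable fun j : ℕ => (1 - q ^ (2 * (j + 1)))⁻¹ - 1 := by
    refine Summable.of_nonneg_of_le
      (fun j => sub_nonneg.2 (one_le_inv_one_sub_pow h0 h1 j)) (fun j => ?_)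
      ((summable_geometric_of_lt_one h0.le h1).mul_right (1 - q)⁻¹)
    have hj := one_sub_pow_pos h0 h1 (n := 2 * (j + 1)) (by omega)
    have h4 : q ^ (2 * (j + 1)) ≤ q ^ j := pow_le_pow_of_le_one h0.le h1.le (by omega)
    have h5 : q ^ (2 * (j + 1)) ≤ q := pow_le_of_le_one h0.le h1.le (by omega)
    have h6 : (1 - q ^ (2 * (j + 1)))⁻¹ - 1 = q ^ (2 * (j + 1)) * (1 - q ^ (2 * (j + 1)))⁻¹ := by
      field_simp; ring
    rw [h6]
    gcongr
  obtain ⟨E, hE⟩ := Real.multipliable_one_add_of_summable hs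
  have ht : Tendsto (fun n : ℕ => invQPochhammer q n) atTop (𝓝 E) := by
    simpa [invQPochhammer_natCast] using hE.tendsto_prod_nat
  have hmono : Monotone fun n : ℕ => invQPochhammer q n := by
    refine monotone_nat_of_le_succ fun n => ?_
    rw [invQPochhammer_natCast, invQPochhammer_natCast, Finset.prod_range_succ]
    refine le_mul_of_one_le_right ?_ (one_le_inv_one_sub_pow h0 h1 n)
    rw [← invQPochhammer_natCast]
    exact invQPochhammer_nonneg h0 h1 n
  have hle : ∀ n : ℕ, invQPochhammer q n ≤ E := fun n => hmono.ge_of_tendsto ht n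
  have hE1 : 1 ≤ E := by simpa [invQPochhammer] using hle 0
  refine ⟨E, by linarith, ?_, fun n => ?_⟩
  · have hn : Tendsto Int.toNat atTop atTop :=
      tendsto_atTop.2 fun b => (eventually_ge_atTop (b : ℤ)).mono fun a ha => by omega
    refine (ht.comp hn).congr' ((eventually_ge_atTop (0 : ℤ)).mono fun a ha => ?_)
    simp [Int.toNat_of_nonneg ha]
  · rcases lt_or_ge n 0 with h | h
    · rw [invQPochhammer_of_neg h]; linarith
    · lift n to ℕ using h
      exact hle n

lemma summable_zpow_sq (h0 : 0 < q) (h1 : q < 1) : Summable fun k : ℤ => q ^ (k ^ 2) := by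
  have h : Summable fun n : ℕ => q ^ ((n : ℤ) ^ 2) := by
    refine Summable.of_nonneg_of_le (fun n => by positivity) (fun n => ?_)
      (summable_geometric_of_lt_one h0.le h1)
    rw [← Nat.cast_pow, zpow_natCast]
    exact pow_le_pow_of_le_one h0.le h1.le (Nat.le_self_pow (by omega) n)
  exact Summable.of_nat_of_neg h (by simpa using h)

lemma abs_tripleCoeff_le (h0 : 0 < q) (h1 : q < 1) {E : ℝ} (hE : ∀ n, invQPochhammer q n ≤ E)
    (N : ℕ) (k : ℤ) : |tripleCoeff q N k| ≤ E * E := by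
  have h := invQPochhammer_nonneg h0 h1
  rw [tripleCoeff, abs_of_nonneg (mul_nonneg (h _) (h _))]
  exact mul_le_mul (hE _) (hE _) (h _) ((h 0).trans (hE 0))

lemma norm_tripleCoeff_mul_le (h0 : 0 < q) (h1 : q < 1) {E : ℝ}
    (hE : ∀ n, invQPochhammer q n ≤ E) (N : ℕ) (k : ℤ) {x : ℝ} (hx : |x| ≤ 1) :
    ‖tripleCoeff q N k * q ^ (k ^ 2) * x‖ ≤ E * E * q ^ (k ^ 2) := by
  have hq : 0 < q ^ (k ^ 2) := by positivity
  rw [Real.norm_eq_abs, abs_mul, abs_mul, abs_of_pos hq]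
  have h2 := abs_tripleCoeff_le h0 h1 hE N k
  calc _ ≤ |tripleCoeff q N k| * q ^ (k ^ 2) * 1 := by gcongr
    _ ≤ _ := by rw [mul_one]; gcongr

lemma summable_tripleCoeff_mul (h0 : 0 < q) (h1 : q < 1) (N : ℕ) {f : ℤ → ℝ}
    (hf : ∀ k, |f k| ≤ 1) : Summable fun k : ℤ => tripleCoeff q N k * q ^ (k ^ 2) * f k := by
  obtain ⟨E, -, -, hE⟩ := exists_tendsto_invQPochhammer h0 h1
  exact Summable.of_norm_bounded ((summable_zpow_sq h0 h1).mul_left (E * E))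
    fun k => norm_tripleCoeff_mul_le h0 h1 hE N k (hf k)

lemma tripleCoeff_succ (h0 : 0 < q) (h1 : q < 1) (N : ℕ) (k : ℤ) :
    (1 - q ^ (4 * N + 2)) * (1 - q ^ (4 * N + 4)) * (tripleCoeff q (N + 1) k * q ^ (k ^ 2)) =
      (1 + q ^ (4 * N + 2)) * (tripleCoeff q N k * q ^ (k ^ 2)) +
      q ^ (2 * N + 1) * (tripleCoeff q N (k - 1) * q ^ ((k - 1) ^ 2) +
        tripleCoeff q N (k + 1) * q ^ ((k + 1) ^ 2)) := by
  have hq := h0.ne'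
  have e := invQPochhammer_sub_one h0 h1
  have a1 : invQPochhammer q (N + k) = (1 - q ^ (2 * (N + k + 1))) * invQPochhammer q (N + k + 1) := by
    rw [← e, add_sub_cancel_right]
  have a2 : invQPochhammer q (N - k) = (1 - q ^ (2 * (N - k + 1))) * invQPochhammer q (N - k + 1) := by
    rw [← e, add_sub_cancel_right]
  have a3 : invQPochhammer q (N + (k - 1)) = (1 - q ^ (2 * (N + k))) * invQPochhammer q (N + k) := by
    rw [← e]; congr 1; ring
  have a4 : invQPochhammer q (N - (k + 1)) = (1 - q ^ (2 * (N - k))) * invQPochhammer q (N - k) := by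
    rw [← e]; congr 1; ring
  have a5 : (N : ℤ) - (k - 1) = N - k + 1 := by ring
  have a6 : (N : ℤ) + (k + 1) = N + k + 1 := by ring
  have a7 : ((N + 1 : ℕ) : ℤ) + k = N + k + 1 := by push_cast; ring
  have a8 : ((N + 1 : ℕ) : ℤ) - k = N - k + 1 := by push_cast; ring
  simp only [tripleCoeff, a3, a4, a5, a6, a7, a8, a1, a2]
  generalize invQPochhammer q (N + k + 1) = a
  generalize invQPochhammer q (N - k + 1) = b
  have b1 : q ^ ((k - 1) ^ 2) = q ^ (k ^ 2) * q * (q ^ k)⁻¹ ^ 2 := by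
    rw [show (k - 1) ^ 2 = k ^ 2 + 1 + (-k + -k) by ring]
    simp only [zpow_add₀ hq, zpow_neg, zpow_one]; ring
  have b2 : q ^ ((k + 1) ^ 2) = q ^ (k ^ 2) * q * (q ^ k) ^ 2 := by
    rw [show (k + 1) ^ 2 = k ^ 2 + 1 + (k + k) by ring]
    simp only [zpow_add₀ hq, zpow_one]; ring
  have b3 : q ^ (2 * ((N : ℤ) + k)) = (q ^ N) ^ 2 * (q ^ k) ^ 2 := by
    rw [show 2 * ((N : ℤ) + k) = N + N + (k + k) by ring]
    simp only [zpow_add₀ hq, zpow_natCast]; ring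
  have b4 : q ^ (2 * ((N : ℤ) - k)) = (q ^ N) ^ 2 * (q ^ k)⁻¹ ^ 2 := by
    rw [show 2 * ((N : ℤ) - k) = N + N + (-k + -k) by ring]
    simp only [zpow_add₀ hq, zpow_natCast, zpow_neg]; ring
  have b5 : q ^ (2 * ((N : ℤ) + k + 1)) = (q ^ N) ^ 2 * (q ^ k) ^ 2 * q ^ 2 := by
    rw [← b3, show 2 * ((N : ℤ) + k + 1) = 2 * (N + k) + (1 + 1) by ring]
    rw [zpow_add₀ hq, zpow_add₀ hq, zpow_one]; ring
  have b6 : q ^ (2 * ((N : ℤ) - k + 1)) = (q ^ N) ^ 2 * (q ^ k)⁻¹ ^ 2 * q ^ 2 := by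
    rw [← b4, show 2 * ((N : ℤ) - k + 1) = 2 * (N - k) + (1 + 1) by ring]
    rw [zpow_add₀ hq, zpow_add₀ hq, zpow_one]; ring
  have b7 : q ^ (4 * N + 2) = (q ^ N) ^ 4 * q ^ 2 := by ring
  have b8 : q ^ (4 * N + 4) = (q ^ N) ^ 4 * q ^ 4 := by ring
  have b9 : q ^ (2 * N + 1) = (q ^ N) ^ 2 * q := by ring
  rw [b1, b2, b3, b4, b5, b6, b7, b8, b9]
  have hz : q ^ k ≠ 0 := zpow_ne_zero k hq
  generalize q ^ k = z at *
  generalize q ^ N = t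
  generalize q ^ (k ^ 2) = g
  field_simp
  ring

/-- One factor of the triple product. -/
noncomputable def tripleFactor (q : ℝ) (j : ℕ) (s : ℝ) : ℝ :=
  1 + 2 * q ^ (2 * j + 1) * cos s + q ^ (4 * j + 2)

lemma tripleFactor_pos (h0 : 0 < q) (h1 : q < 1) (j : ℕ) (s : ℝ) : 0 < tripleFactor q j s := by
  have h2 := one_sub_pow_pos h0 h1 (n := 2 * j + 1) (by omega)
  have h3 : q ^ (4 * j + 2) = (q ^ (2 * j + 1)) ^ 2 := by ring
  have h4 : 0 < q ^ (2 * j + 1) := by positivity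
  rw [tripleFactor, h3]
  nlinarith [neg_one_le_cos s, pow_pos h2 2]

lemma tripleFactor_le (h0 : 0 < q) (j : ℕ) {a b : ℝ} (h : cos b ≤ cos a) :
    tripleFactor q j b ≤ tripleFactor q j a := by
  unfold tripleFactor
  gcongr

lemma tsum_tripleCoeff_succ (h0 : 0 < q) (h1 : q < 1) (N : ℕ) (s : ℝ) :
    (1 - q ^ (4 * N + 2)) * (1 - q ^ (4 * N + 4)) *
        ∑' k : ℤ, tripleCoeff q (N + 1) k * q ^ (k ^ 2) * cos (k * s) =
      tripleFactor q N s * ∑' k : ℤ, tripleCoeff q N k * q ^ (k ^ 2) * cos (k * s) := by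
  set F : ℤ → ℝ := fun k => tripleCoeff q N k * q ^ (k ^ 2) with hF
  have hs (c : ℤ) : Summable fun k : ℤ => F k * cos ((k + c) * s) :=
    summable_tripleCoeff_mul h0 h1 N fun k => abs_cos_le_one _
  have hs0 : Summable fun k : ℤ => F k * cos (k * s) := by simpa using hs 0
  have hshift (c : ℤ) : ∑' k : ℤ, F (k - c) * cos (k * s) = ∑' k : ℤ, F k * cos ((k + c) * s) := by
    rw [← (Equiv.addRight c).tsum_eq]
    simp
  have hsshift (c : ℤ) : Summable fun k : ℤ => F (k - c) * cos (k * s) := by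
    rw [← (Equiv.addRight c).summable_iff]
    simpa [Function.comp_def] using hs c
  have hp := hsshift 1
  have hm := hsshift (-1)
  have hp' := hshift 1
  have hm' := hshift (-1)
  have hcos : ∑' k : ℤ, F k * cos ((k + (1 : ℤ)) * s) + ∑' k : ℤ, F k * cos ((k + (-1 : ℤ)) * s) =
      2 * cos s * ∑' k : ℤ, F k * cos (k * s) := by
    rw [← (hs 1).tsum_add (hs (-1)), ← tsum_mul_left]
    refine tsum_congr fun k => ?_
    push_cast
    rw [show ((k : ℝ) + 1) * s = k * s + s by ring, show ((k : ℝ) + -1) * s = k * s - s by ring,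
      cos_add, cos_sub]
    ring
  calc _ = ∑' k : ℤ, ((1 + q ^ (4 * N + 2)) * (F k * cos (k * s)) +
        q ^ (2 * N + 1) * (F (k - 1) * cos (k * s) + F (k - -1) * cos (k * s))) := by
        rw [← tsum_mul_left]
        refine tsum_congr fun k => ?_
        rw [← mul_assoc, tripleCoeff_succ h0 h1, sub_neg_eq_add]
        simp only [hF]
        ring
    _ = (1 + q ^ (4 * N + 2)) * ∑' k : ℤ, F k * cos (k * s) +
        q ^ (2 * N + 1) * (2 * cos s * ∑' k : ℤ, F k * cos (k * s)) := by
        rw [(hs0.mul_left _).tsum_add ((hp.add hm).mul_left _), tsum_mul_left, tsum_mul_left,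
          hp.tsum_add hm, hp', hm', hcos]
    _ = _ := by rw [tripleFactor]; ring

/-- The finite Jacobi triple product identity. -/
lemma prod_mul_tsum_tripleCoeff (h0 : 0 < q) (h1 : q < 1) (N : ℕ) (s : ℝ) :
    (∏ j ∈ Finset.range N, (1 - q ^ (4 * j + 2)) * (1 - q ^ (4 * j + 4))) *
        ∑' k : ℤ, tripleCoeff q N k * q ^ (k ^ 2) * cos (k * s) =
      ∏ j ∈ Finset.range N, tripleFactor q j s := by
  induction N with
  | zero =>
    rw [tsum_eq_single 0]
    · simp [tripleCoeff, invQPochhammer]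
    · intro k hk
      rcases lt_or_gt_of_ne hk with h | h
      · simp [tripleCoeff, invQPochhammer_of_neg h]
      · simp [tripleCoeff, invQPochhammer_of_neg (neg_lt_zero.2 h)]
  | succ N ih =>
    rw [Finset.prod_range_succ, Finset.prod_range_succ, ← ih, mul_assoc,
      tsum_tripleCoeff_succ h0 h1]
    ring

lemma tendsto_tsum_tripleCoeff (h0 : 0 < q) (h1 : q < 1) :
    ∃ E : ℝ, 0 < E ∧ ∀ s, Tendsto
      (fun N => ∑' k : ℤ, tripleCoeff q N k * q ^ (k ^ 2) * cos (k * s)) atTop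
      (𝓝 (E * ∑' k : ℤ, q ^ (k ^ 2) * cos (k * s))) := by
  obtain ⟨E, hE0, hE, hle⟩ := exists_tendsto_invQPochhammer h0 h1
  refine ⟨E * E, by positivity, fun s => ?_⟩
  rw [← tsum_mul_left]
  refine tendsto_tsum_of_dominated_convergence ((summable_zpow_sq h0 h1).mul_left (E * E))
    (fun k => ?_)
    (Eventually.of_forall fun N k => norm_tripleCoeff_mul_le h0 h1 hle N k (abs_cos_le_one _))
  simp only [mul_assoc _ (q ^ (k ^ 2))]
  refine Tendsto.mul_const _ ?_
  refine (hE.comp ?_).mul (hE.comp ?_)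
  · exact tendsto_atTop_add_const_right _ _ tendsto_natCast_atTop_atTop
  · exact tendsto_atTop_add_const_right _ (-k) tendsto_natCast_atTop_atTop

lemma tsum_zpow_sq_mul_cos_mul_le (h0 : 0 < q) (h1 : q < 1) {a b : ℝ} (h : cos b ≤ cos a) :
    (∑' k : ℤ, q ^ (k ^ 2) * cos (k * b)) * tripleFactor q 0 a ≤
      (∑' k : ℤ, q ^ (k ^ 2) * cos (k * a)) * tripleFactor q 0 b := by
  obtain ⟨E, hE0, hE⟩ := tendsto_tsum_tripleCoeff h0 h1
  have key := le_of_tendsto_of_tendsto ((hE b).mul_const (tripleFactor q 0 a))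
    ((hE a).mul_const (tripleFactor q 0 b)) <| (eventually_ge_atTop 1).mono fun N hN => by
      have hD : 0 < ∏ j ∈ Finset.range N, (1 - q ^ (4 * j + 2)) * (1 - q ^ (4 * j + 4)) :=
        Finset.prod_pos fun j _ =>
          mul_pos (one_sub_pow_pos h0 h1 (by omega)) (one_sub_pow_pos h0 h1 (by omega))
      refine le_of_mul_le_mul_left ?_ hD
      rw [← mul_assoc, ← mul_assoc, prod_mul_tsum_tripleCoeff h0 h1,
        prod_mul_tsum_tripleCoeff h0 h1]
      obtain ⟨M, rfl⟩ : ∃ M, N = M + 1 := ⟨N - 1, by omega⟩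
      rw [Finset.prod_range_succ', Finset.prod_range_succ']
      have hle : ∏ j ∈ Finset.range M, tripleFactor q (j + 1) b ≤
          ∏ j ∈ Finset.range M, tripleFactor q (j + 1) a :=
        Finset.prod_le_prod (fun j _ => (tripleFactor_pos h0 h1 _ _).le)
          fun j _ => tripleFactor_le h0 _ h
      have hpos := mul_pos (tripleFactor_pos h0 h1 0 a) (tripleFactor_pos h0 h1 0 b)
      nlinarith [mul_le_mul_of_nonneg_right hle hpos.le]
  rw [mul_assoc, mul_assoc] at key
  exact le_of_mul_le_mul_left key hE0

end

lemma exp_neg_zpow (c : ℝ) (m : ℤ) : exp (-c) ^ m = exp (-c * m) := by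
  rw [exp_mul, rpow_intCast]

/-- Poisson summation for the periodised Gaussian. -/
lemma tsum_gaussian_eq_tsum_cos {r : ℝ} (hr : 0 < r) (s : ℝ) :
    ∑' k : ℤ, exp (-r * (s + 2 * π * (k : ℝ)) ^ 2) =
      (1 / (4 * π * r)) ^ (1 / 2 : ℝ) *
        ∑' k : ℤ, exp (-(1 / (4 * r))) ^ (k ^ 2) * cos (k * s) := by
  set A : ℝ := 1 / (4 * π * r) with hA
  have hA0 : 0 < A := by positivity
  have hAc : (A : ℂ) = 1 / (4 * π * r) := by simp [hA]
  have hrc : (r : ℂ) ≠ 0 := by exact_mod_cast hr.ne'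
  have hpc : (π : ℂ) ≠ 0 := by exact_mod_cast pi_ne_zero
  have h := Complex.tsum_exp_neg_quadratic (a := (A : ℂ)) (by simpa using hA0)
    (-Complex.I * s / (2 * π))
  have hl (n : ℤ) : Complex.exp (-π * A * n ^ 2 + 2 * π * (-Complex.I * s / (2 * π)) * n) =
      ((exp (-(1 / (4 * r))) ^ (n ^ 2) : ℝ) : ℂ) * Complex.exp (((-(n * s) : ℝ) : ℂ) * Complex.I) := by
    rw [exp_neg_zpow, Complex.ofReal_exp, ← Complex.exp_add, hAc]
    congr 1
    push_cast
    field_simp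
  have hr' (n : ℤ) : Complex.exp (-π / A * (n + Complex.I * (-Complex.I * s / (2 * π))) ^ 2) =
      ((exp (-r * (s + 2 * π * (n : ℝ)) ^ 2) : ℝ) : ℂ) := by
    rw [Complex.ofReal_exp, hAc]
    congr 1
    have : Complex.I * (-Complex.I * s / (2 * π)) = s / (2 * π) := by
      linear_combination (-(s : ℂ) / (2 * π)) * Complex.I_mul_I
    rw [this]
    push_cast
    field_simp
    ring
  have hc : (A : ℂ) ^ (1 / 2 : ℂ) = ((A ^ (1 / 2 : ℝ) : ℝ) : ℂ) := by
    rw [Complex.ofReal_cpow hA0.le]; norm_num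
  simp only [hl, hr', hc] at h
  rw [← Complex.ofReal_tsum] at h
  have hq1 : exp (-(1 / (4 * r))) < 1 := exp_lt_one_iff.2 (neg_lt_zero.2 (by positivity))
  have hsum : Summable fun n : ℤ => ((exp (-(1 / (4 * r))) ^ (n ^ 2) : ℝ) : ℂ) *
      Complex.exp (((-(n * s) : ℝ) : ℂ) * Complex.I) := by
    refine Summable.of_norm_bounded (summable_zpow_sq (exp_pos _) hq1) fun n => ?_
    rw [norm_mul, Complex.norm_exp_ofReal_mul_I, mul_one, Complex.norm_real, Real.norm_eq_abs,
      abs_of_pos (by positivity)]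
  have hre := congrArg Complex.re h
  rw [Complex.re_tsum hsum, ← Complex.ofReal_one, ← Complex.ofReal_div, Complex.re_ofReal_mul,
    Complex.ofReal_re] at hre
  simp only [Complex.re_ofReal_mul, Complex.exp_ofReal_mul_I_re, cos_neg] at hre
  have hA' : A ^ (1 / 2 : ℝ) ≠ 0 := (rpow_pos_of_pos hA0 _).ne'
  rw [hre]
  field_simp

lemma tsum_gaussian_pos {r : ℝ} (hr : 0 < r) (s : ℝ) :
    0 < ∑' k : ℤ, exp (-r * (s + 2 * π * (k : ℝ)) ^ 2) := by
  have hq1 : exp (-(2 * π ^ 2 * r)) < 1 := exp_lt_one_iff.2 (neg_lt_zero.2 (by positivity))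
  have hs : Summable fun k : ℤ => exp (-r * (s + 2 * π * (k : ℝ)) ^ 2) := by
    refine Summable.of_nonneg_of_le (fun k => (exp_pos _).le) (fun k => ?_)
      ((summable_zpow_sq (exp_pos _) hq1).mul_left (exp (r * s ^ 2)))
    rw [exp_neg_zpow, ← exp_add, exp_le_exp]
    push_cast
    nlinarith [mul_nonneg hr.le (sq_nonneg (s + π * k))]
  exact hs.tsum_pos (fun k => (exp_pos _).le) 0 (exp_pos _)

theorem stmt5 (r : ℝ) (hr : 0 < r) :
    StrictAntiOn (fun s : ℝ => ∑' k : ℤ, Real.exp (-r * (s + 2 * π * (k : ℝ)) ^ 2))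
      (Set.Ioo 0 π) := by
  intro a ha b hb hab
  have hcos : cos b < cos a := cos_lt_cos_of_nonneg_of_le_pi ha.1.le hb.2.le hab
  have hpos := tsum_gaussian_pos hr b
  simp only [tsum_gaussian_eq_tsum_cos hr] at hpos ⊢
  have hC : 0 < (1 / (4 * π * r)) ^ (1 / 2 : ℝ) := by positivity
  have hq0 := exp_pos (-(1 / (4 * r)))
  have hq1 : exp (-(1 / (4 * r))) < 1 := exp_lt_one_iff.2 (neg_lt_zero.2 (by positivity))
  have hΘ := pos_of_mul_pos_right hpos hC.le
  refine mul_lt_mul_of_pos_left ?_ hC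
  refine lt_of_mul_lt_mul_right ?_ (tripleFactor_pos hq0 hq1 0 b).le
  refine lt_of_lt_of_le (mul_lt_mul_of_pos_left ?_ hΘ)
    (tsum_zpow_sq_mul_cos_mul_le hq0 hq1 hcos.le)
  unfold tripleFactor
  gcongr
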